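/- Let Ω_{trace} = c₀ □ + c† S + ξ T act on H = ℂ[[Y^A]] ⊗ ℂ[a^{†A}] ⊗ Λ[c₀, c†, ξ] with A = 0,...,d, d+1 ≥ 3, where □ = Σ ∂²/∂Y^A∂Y_A, S = Σ (∂/∂a†_A)(∂/∂Y^A), T = Σ (∂/∂a†_A)(∂/∂a^{†A}). Assign ghost degree 1 to each of c₀, c†, ξ. Then Ω_{trace}² = 0, the cohomology in positive ghost degree vanishes, and the degree-zero cohomology is ker □ ∩ ker S ∩ ker T inside the ghost-independent subspace (the space of totally traceless elements). -/

import Mathlib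

namespace HStrace

variable {n : ℕ}

/-- The ghost-free part of the space: formal power series in `Y^A`
(`A = 0,…,d`, `n = d+1`) with coefficients that are polynomials in `a^{†A}`. -/
abbrev H0 (n : ℕ) := (Fin n →₀ ℕ) → MvPolynomial (Fin n) ℂ

/-- `∂/∂Y^A`. -/
noncomputable def dY (A : Fin n) (f : H0 n) : H0 n :=
  fun m => ((m A : ℂ) + 1) • f (m + Finsupp.single A 1)

/-- `∂/∂a^{†A}`. -/
noncomputable def da (A : Fin n) (f : H0 n) : H0 n :=
  fun m => MvPolynomial.pderiv A (f m)

/-- `□ = Σ η^{AB} ∂²/∂Y^A∂Y^B`. -/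
noncomputable def box (η : Fin n → Fin n → ℂ) (f : H0 n) : H0 n :=
  ∑ A, ∑ B, η A B • dY A (dY B f)

/-- `S = Σ η^{AB} (∂/∂a^{†A})(∂/∂Y^B)`. -/
noncomputable def opS (η : Fin n → Fin n → ℂ) (f : H0 n) : H0 n :=
  ∑ A, ∑ B, η A B • da A (dY B f)

/-- `T = Σ η^{AB} (∂/∂a^{†A})(∂/∂a^{†B})`. -/
noncomputable def opT (η : Fin n → Fin n → ℂ) (f : H0 n) : H0 n :=
  ∑ A, ∑ B, η A B • da A (da B f)

/-- The full space `H = H0 ⊗ Λ[c₀, c†, ξ]`: components indexed by the ghost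
monomial `c₀^{ε₁} (c†)^{ε₂} ξ^{ε₃}`. -/
abbrev H (n : ℕ) := (Bool × Bool × Bool) → H0 n

/-- Ghost degree of a component. -/
def deg (ε : Bool × Bool × Bool) : ℕ := ε.1.toNat + ε.2.1.toNat + ε.2.2.toNat

/-- `Ω_trace = c₀ □ + c† S + ξ T` (left multiplication by the odd ghosts). -/
noncomputable def OmTrace (η : Fin n → Fin n → ℂ) (f : H n) : H n := fun ε =>
  (if ε.1 = true then box η (f (false, ε.2.1, ε.2.2)) else 0)
  + (if ε.2.1 = true then ((-1 : ℂ) ^ ε.1.toNat) • opS η (f (ε.1, false, ε.2.2)) else 0)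
  + (if ε.2.2 = true then ((-1 : ℂ) ^ (ε.1.toNat + ε.2.1.toNat)) • opT η (f (ε.1, ε.2.1, false)) else 0)

end HStrace

namespace HStrace
open Polynomial in
theorem dvd_of_C_mul {D : Type*} [CommRing D] [IsDomain D] {a : D[X]} (ha : a.Monic) {G : D}
    (hG : G ≠ 0) {p : D[X]} (h : a ∣ C G * p) : a ∣ p := by
  rw [← Polynomial.modByMonic_eq_zero_iff_dvd ha] at h ⊢
  rw [← Polynomial.smul_eq_C_mul, Polynomial.smul_modByMonic] at h
  exact (smul_eq_zero.mp h).resolve_left hG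

open Polynomial in
theorem regular_two {D : Type*} [CommRing D] [IsDomain D] (α β : D)
    (r u : D[X][X]) (h : (X ^ 2 + C (C β)) * r = C (X ^ 2 + C α) * u) :
    ∃ v, r = C (X ^ 2 + C α) * v := by
  set a : D[X] := X ^ 2 + C α with ha
  have hm : (X ^ 2 + C (C β) : D[X][X]).Monic := monic_X_pow_add_C _ (by norm_num)
  have h2 := congrArg (Polynomial.map (Ideal.Quotient.mk (Ideal.span {a}))) h
  have h0 : (Ideal.Quotient.mk (Ideal.span {a})) a = 0 :=
    Ideal.Quotient.eq_zero_iff_mem.mpr (Ideal.mem_span_singleton_self a)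
  rw [Polynomial.map_mul, Polynomial.map_mul, Polynomial.map_C, h0, C_0, zero_mul] at h2
  have h3 := (hm.map (Ideal.Quotient.mk (Ideal.span {a}))).mul_right_eq_zero_iff.mp h2
  have : C a ∣ r := by
    rw [Polynomial.C_dvd_iff_dvd_coeff]
    intro i
    have := congrArg (fun p => p.coeff i) h3
    simp only [coeff_map, coeff_zero] at this
    rwa [Ideal.Quotient.eq_zero_iff_mem, Ideal.mem_span_singleton] at this
  exact this

open Polynomial in
theorem regular_three {D : Type*} [CommRing D] [IsDomain D] (α β b : D) (hG : α * β - b * b ≠ 0)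
    (r u v : D[X][X])
    (h : (C X * X + C (C b)) * r = C (X ^ 2 + C α) * u + (X ^ 2 + C (C β)) * v) :
    ∃ u' v', r = C (X ^ 2 + C α) * u' + (X ^ 2 + C (C β)) * v' := by
  set a : D[X] := X ^ 2 + C α with ha
  set z : D[X][X] := X ^ 2 + C (C β) with hz
  have hm : z.Monic := monic_X_pow_add_C _ (by norm_num)
  have ham : a.Monic := monic_X_pow_add_C _ (by norm_num)
  have h1 : ∃ u1 v1, C (C (α * β - b * b)) * r = C a * u1 + z * v1 := by
    refine ⟨(C X * X - C (C b)) * u - X ^ 2 * r, (C X * X - C (C b)) * v + C (C α) * r, ?_⟩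
    have e := congrArg (fun t => (C X * X - C (C b)) * t) h
    simp only [ha, hz, C_add, C_sub, C_mul, C_pow] at e ⊢
    linear_combination e
  obtain ⟨u1, v1, h1⟩ := h1
  have h2 := congrArg (fun t => t %ₘ z) h1
  simp only [Polynomial.add_modByMonic] at h2
  rw [(Polynomial.modByMonic_eq_zero_iff_dvd hm).mpr (dvd_mul_right z v1), add_zero,
    ← smul_eq_C_mul, ← smul_eq_C_mul, smul_modByMonic, smul_modByMonic] at h2
  have h3 : C a ∣ r %ₘ z := by
    rw [Polynomial.C_dvd_iff_dvd_coeff]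
    intro i
    have := congrArg (fun p => p.coeff i) h2
    simp only [coeff_smul, smul_eq_mul] at this
    exact dvd_of_C_mul ham hG ⟨_, this⟩
  obtain ⟨w, hw⟩ := h3
  exact ⟨w, r /ₘ z, by rw [← hw]; exact (modByMonic_add_div r z).symm⟩

/-- The bilinear form of a matrix. -/
noncomputable def bil {n : ℕ} (M : Matrix (Fin n) (Fin n) ℂ) :
    LinearMap.BilinForm ℂ (Fin n → ℂ) := Matrix.toLinearMap₂' ℂ M

theorem bil_apply {n : ℕ} (M : Matrix (Fin n) (Fin n) ℂ) (x y : Fin n → ℂ) :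
    bil M x y = dotProduct x (M.mulVec y) := Matrix.toLinearMap₂'_apply' M x y

theorem exists_diag (n : ℕ) (η ηinv : Fin n → Fin n → ℂ)
    (hsymm : ∀ A B, η A B = η B A)
    (hinv : ∀ A C, (∑ B, η A B * ηinv B C) = if A = C then 1 else 0) :
    ∃ P : Matrix (Fin n) (Fin n) ℂ, P.transpose * Matrix.of η * P = 1 := by
  classical
  have key0 : ∀ M : Matrix (Fin n) (Fin n) ℂ, M.transpose = M →
      (QuadraticMap.associated (R := ℂ) (LinearMap.BilinMap.toQuadraticMap (bil M))) =
        bil M := by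
    intro M hM
    apply QuadraticMap.associated_left_inverse
    intro x y
    rw [bil_apply, bil_apply, Matrix.dotProduct_mulVec,
      ← Matrix.mulVec_transpose, hM, dotProduct_comm]
  have key : ∀ M N : Matrix (Fin n) (Fin n) ℂ, M.transpose = M → M * N = 1 →
      (QuadraticMap.associated (R := ℂ)
        (LinearMap.BilinMap.toQuadraticMap (bil M))).SeparatingLeft := by
    intro M N hM hMN
    rw [key0 M hM]
    refine LinearMap.separatingLeft_toLinearMap₂'_iff_det_ne_zero.mpr ?_
    intro h
    have := congrArg Matrix.det hMN
    simp [h] at this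
  have ht : (Matrix.of η).transpose = Matrix.of η := by ext i j; simp [hsymm j i]
  obtain ⟨f⟩ := QuadraticForm.equivalent_of_isAlgClosed
    (LinearMap.BilinMap.toQuadraticMap (bil (1 : Matrix (Fin n) (Fin n) ℂ)))
    (LinearMap.BilinMap.toQuadraticMap (bil (Matrix.of η)))
    (key 1 1 (by simp) (by simp)) (key _ (Matrix.of ηinv) ht (by
      ext i j; simp [Matrix.mul_apply, hinv, Matrix.one_apply]))
  refine ⟨LinearMap.toMatrix' f.toLinearEquiv.toLinearMap, ?_⟩
  have hf : ∀ x y, bil (Matrix.of η) (f x) (f y) =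
      bil (1 : Matrix (Fin n) (Fin n) ℂ) x y := by
    intro x y
    have e1 := LinearMap.congr_fun₂ (key0 _ ht) (f x) (f y)
    have e2 := LinearMap.congr_fun₂ (key0 1 (by simp)) x y
    rw [← e1, ← e2, QuadraticMap.associated_apply, QuadraticMap.associated_apply]
    have : f x + f y = f (x + y) := (f.toLinearEquiv.map_add x y).symm
    rw [this, f.map_app, f.map_app, f.map_app]
  ext i j
  have := hf (Pi.single i 1) (Pi.single j 1)
  rw [bil_apply, bil_apply] at this
  have h1 : dotProduct (Pi.single i 1) ((1 : Matrix (Fin n) (Fin n) ℂ).mulVec (Pi.single j 1))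
    = (1 : Matrix (Fin n) (Fin n) ℂ) i j := by simp [Matrix.one_apply]
  rw [← h1, ← this]
  simp only [Matrix.mul_apply, Matrix.transpose_apply, LinearMap.toMatrix'_apply, dotProduct,
    Matrix.mulVec, Finset.sum_mul, Finset.mul_sum]
  rw [Finset.sum_comm]
  refine Finset.sum_congr rfl fun a _ => Finset.sum_congr rfl fun b _ => ?_
  rw [mul_assoc]
  rfl

open MvPolynomial

/-- Linear change of both sets of variables. -/
noncomputable def lin {n : ℕ} (P : Matrix (Fin n) (Fin n) ℂ) :
    MvPolynomial (Fin n ⊕ Fin n) ℂ →ₐ[ℂ] MvPolynomial (Fin n ⊕ Fin n) ℂ :=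
  aeval (Sum.elim (fun A => ∑ j, C (P A j) * X (Sum.inl j)) (fun A => ∑ j, C (P A j) * X (Sum.inr j)))

theorem lin_comp {n : ℕ} (P Q : Matrix (Fin n) (Fin n) ℂ) (h : P * Q = 1) :
    (lin Q).comp (lin P) = AlgHom.id ℂ _ := by
  have key : ∀ (s : Fin n → Fin n ⊕ Fin n) (A : Fin n),
      ∑ j, C (P A j) * ∑ k, C (Q j k) * X (s k) = (X (s A) : MvPolynomial (Fin n ⊕ Fin n) ℂ) := by
    intro s A
    simp only [Finset.mul_sum]
    rw [Finset.sum_comm]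
    have : ∀ k, ∑ j, C (P A j) * (C (Q j k) * X (s k)) =
        C ((P * Q) A k) * (X (s k) : MvPolynomial (Fin n ⊕ Fin n) ℂ) := by
      intro k
      simp [Matrix.mul_apply, Finset.sum_mul, mul_assoc]
    simp only [this, h]
    simp [Matrix.one_apply]
  apply MvPolynomial.algHom_ext
  rintro (A | A)
  · simpa [lin, algHom_C] using key Sum.inl A
  · simpa [lin, algHom_C] using key Sum.inr A

/-- The index equivalence. -/
def idx (m : ℕ) : Fin (m + 1) ⊕ Fin (m + 1) ≃ Option (Option (Fin m ⊕ Fin m)) where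
  toFun := Sum.elim (Fin.cases none (fun i => some (some (Sum.inl i))))
    (Fin.cases (some none) (fun i => some (some (Sum.inr i))))
  invFun o := match o with
    | none => Sum.inl 0
    | some none => Sum.inr 0
    | some (some (Sum.inl i)) => Sum.inl i.succ
    | some (some (Sum.inr i)) => Sum.inr i.succ
  left_inv := by
    rintro (i | i) <;> refine Fin.cases ?_ (fun j => ?_) i <;> simp
  right_inv := by
    rintro (_ | _ | i | i) <;> simp

/-- Polynomials in both sets of variables as iterated polynomials. -/
noncomputable def toR2 (m : ℕ) : MvPolynomial (Fin (m + 1) ⊕ Fin (m + 1)) ℂ ≃ₐ[ℂ]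
    Polynomial (Polynomial (MvPolynomial (Fin m ⊕ Fin m) ℂ)) :=
  (renameEquiv ℂ (idx m)).trans ((optionEquivLeft ℂ (Option (Fin m ⊕ Fin m))).trans
    (Polynomial.mapAlgEquiv (optionEquivLeft ℂ (Fin m ⊕ Fin m))))

theorem toR2_inl_zero (m : ℕ) : toR2 m (X (Sum.inl 0)) = Polynomial.X := by
  simp [toR2, idx]
theorem toR2_inr_zero (m : ℕ) : toR2 m (X (Sum.inr 0)) = Polynomial.C Polynomial.X := by
  simp [toR2, idx]
theorem toR2_inl_succ (m : ℕ) (i : Fin m) :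
    toR2 m (X (Sum.inl i.succ)) = Polynomial.C (Polynomial.C (X (Sum.inl i))) := by
  simp [toR2, idx]
theorem toR2_inr_succ (m : ℕ) (i : Fin m) :
    toR2 m (X (Sum.inr i.succ)) = Polynomial.C (Polynomial.C (X (Sum.inr i))) := by
  simp [toR2, idx]

theorem lin_quad {n : ℕ} (η : Fin n → Fin n → ℂ) (P : Matrix (Fin n) (Fin n) ℂ)
    (hP : P.transpose * Matrix.of η * P = 1) (s t : Fin n → MvPolynomial (Fin n ⊕ Fin n) ℂ) :
    ∑ A, ∑ B, C (η A B) * (∑ j, C (P A j) * s j) * (∑ j, C (P B j) * t j) = ∑ j, s j * t j := by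
  have h1 : ∀ j k, ∑ A, ∑ B, C (η A B) * (C (P A j) * s j) * (C (P B k) * t k) =
      C ((1 : Matrix (Fin n) (Fin n) ℂ) j k) * (s j * t k) := by
    intro j k
    rw [← hP]
    simp only [Matrix.mul_apply, Matrix.transpose_apply, Matrix.of_apply, Finset.sum_mul, map_sum,
      map_mul]
    rw [Finset.sum_comm]
    refine Finset.sum_congr rfl fun _ _ => Finset.sum_congr rfl fun _ _ => ?_
    ring
  have h2 : ∑ A, ∑ B, C (η A B) * (∑ j, C (P A j) * s j) * (∑ j, C (P B j) * t j) =
      ∑ j, ∑ k, ∑ A, ∑ B, C (η A B) * (C (P A j) * s j) * (C (P B k) * t k) := by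
    simp only [Finset.mul_sum, Finset.sum_mul]
    calc _ = ∑ A, ∑ B, ∑ j, ∑ k, C (η A B) * (C (P A j) * s j) * (C (P B k) * t k) :=
          Finset.sum_congr rfl fun _ _ => Finset.sum_congr rfl fun _ _ => Finset.sum_comm
      _ = ∑ A, ∑ j, ∑ B, ∑ k, C (η A B) * (C (P A j) * s j) * (C (P B k) * t k) :=
          Finset.sum_congr rfl fun _ _ => Finset.sum_comm
      _ = ∑ j, ∑ A, ∑ B, ∑ k, C (η A B) * (C (P A j) * s j) * (C (P B k) * t k) :=
          Finset.sum_comm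
      _ = ∑ j, ∑ A, ∑ k, ∑ B, C (η A B) * (C (P A j) * s j) * (C (P B k) * t k) :=
          Finset.sum_congr rfl fun _ _ => Finset.sum_congr rfl fun _ _ => Finset.sum_comm
      _ = _ := Finset.sum_congr rfl fun _ _ => Finset.sum_comm
  rw [h2]
  simp only [h1]
  simp [Matrix.one_apply]

/-- Quadratic elements. -/
noncomputable def quad {n : ℕ} (η : Fin n → Fin n → ℂ) (s t : Fin n → Fin n ⊕ Fin n) :
    MvPolynomial (Fin n ⊕ Fin n) ℂ := ∑ A, ∑ B, C (η A B) * X (s A) * X (t B)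

theorem exists_equiv (m : ℕ) (hm : 2 ≤ m) (η ηinv : Fin (m + 1) → Fin (m + 1) → ℂ)
    (hsymm : ∀ A B, η A B = η B A)
    (hinv : ∀ A C, (∑ B, η A B * ηinv B C) = if A = C then 1 else 0) :
    ∃ (e : MvPolynomial (Fin (m + 1) ⊕ Fin (m + 1)) ℂ ≃ₐ[ℂ]
      Polynomial (Polynomial (MvPolynomial (Fin m ⊕ Fin m) ℂ)))
      (α β b : MvPolynomial (Fin m ⊕ Fin m) ℂ), α * β - b * b ≠ 0 ∧
      e (quad η Sum.inr Sum.inr) = Polynomial.C (Polynomial.X ^ 2 + Polynomial.C α) ∧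
      e (quad η Sum.inl Sum.inl) = Polynomial.X ^ 2 + Polynomial.C (Polynomial.C β) ∧
      e (quad η Sum.inr Sum.inl) = Polynomial.C Polynomial.X * Polynomial.X
        + Polynomial.C (Polynomial.C b) := by
  obtain ⟨P, hP⟩ := exists_diag _ η ηinv hsymm hinv
  have hP' := mul_eq_one_comm.mp hP
  let L := AlgEquiv.ofAlgHom (lin P) (lin (P.transpose * Matrix.of η)) (lin_comp _ _ hP)
    (lin_comp _ _ hP')
  have hL : ∀ x, L x = lin P x := fun x => rfl
  refine ⟨L.trans (toR2 m), ∑ i, X (Sum.inr i) * X (Sum.inr i), ∑ i, X (Sum.inl i) * X (Sum.inl i),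
    ∑ i, X (Sum.inr i) * X (Sum.inl i), ?_, ?_, ?_, ?_⟩
  · intro h
    let i0 : Fin m := ⟨0, by omega⟩
    let i1 : Fin m := ⟨1, by omega⟩
    have := congrArg (MvPolynomial.eval
      (Sum.elim (fun i => if i = i0 then 1 else 0) (fun i => if i = i1 then 1 else 0))) h
    simp [i0, i1] at this
  · have : L (quad η Sum.inr Sum.inr) = ∑ j, X (Sum.inr j) * X (Sum.inr j) := by
      rw [← lin_quad η P hP (fun j => X (Sum.inr j)) (fun j => X (Sum.inr j)), hL]
      simp [quad, lin, algHom_C]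
    rw [AlgEquiv.trans_apply, this, Fin.sum_univ_succ]
    simp [toR2_inr_zero, toR2_inr_succ, pow_two]
  · have : L (quad η Sum.inl Sum.inl) = ∑ j, X (Sum.inl j) * X (Sum.inl j) := by
      rw [← lin_quad η P hP (fun j => X (Sum.inl j)) (fun j => X (Sum.inl j)), hL]
      simp [quad, lin, algHom_C]
    rw [AlgEquiv.trans_apply, this, Fin.sum_univ_succ]
    simp [toR2_inl_zero, toR2_inl_succ, pow_two]
  · have : L (quad η Sum.inr Sum.inl) = ∑ j, X (Sum.inr j) * X (Sum.inl j) := by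
      rw [← lin_quad η P hP (fun j => X (Sum.inr j)) (fun j => X (Sum.inl j)), hL]
      simp [quad, lin, algHom_C]
    rw [AlgEquiv.trans_apply, this, Fin.sum_univ_succ]
    simp [toR2_inl_zero, toR2_inl_succ, toR2_inr_zero, toR2_inr_succ]

/-- Action of a polynomial ring through commuting endomorphisms. -/
noncomputable def actHom {ι A M : Type*} [CommRing A] [AddCommGroup M] [Module A M]
    (D : ι → Module.End A M) (h : ∀ i j, D i * D j = D j * D i) :
    MvPolynomial ι A →ₐ[A] Module.End A M :=
  letI : CommRing (Algebra.adjoin A (Set.range D)) :=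
    Algebra.adjoinCommRingOfComm A (by rintro _ ⟨i, rfl⟩ _ ⟨j, rfl⟩; exact h i j)
  (Algebra.adjoin A (Set.range D)).val.comp
    (aeval (fun i => (⟨D i, Algebra.subset_adjoin ⟨i, rfl⟩⟩ : Algebra.adjoin A (Set.range D))))

theorem actHom_X {ι A M : Type*} [CommRing A] [AddCommGroup M] [Module A M]
    (D : ι → Module.End A M) (h : ∀ i j, D i * D j = D j * D i) (i : ι) :
    actHom D h (X i) = D i := by
  simp [actHom]

/-- The weight `∏ (k i)!`. -/
noncomputable def wt {n : ℕ} (k : Fin n →₀ ℕ) : ℂ := ∏ i, ((k i).factorial : ℂ)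

theorem wt_ne {n : ℕ} (k : Fin n →₀ ℕ) : wt k ≠ 0 :=
  Finset.prod_ne_zero_iff.mpr fun i _ => by exact_mod_cast (k i).factorial_ne_zero

theorem wt_zero {n : ℕ} : wt (0 : Fin n →₀ ℕ) = 1 := by simp [wt]

theorem wt_add {n : ℕ} (k : Fin n →₀ ℕ) (i : Fin n) :
    wt (k + Finsupp.single i 1) = wt k * ((k i : ℂ) + 1) := by
  unfold wt
  rw [← Finset.mul_prod_erase _ _ (Finset.mem_univ i),
    ← Finset.mul_prod_erase _ (fun i => ((k i).factorial : ℂ)) (Finset.mem_univ i)]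
  have : ∏ x ∈ Finset.univ.erase i, ((((k + Finsupp.single i 1 : Fin n →₀ ℕ)) x).factorial : ℂ) =
      ∏ x ∈ Finset.univ.erase i, ((k x).factorial : ℂ) := by
    refine Finset.prod_congr rfl fun x hx => ?_
    have : i ≠ x := (Finset.ne_of_mem_erase hx).symm
    simp [this]
  rw [this]
  simp [Nat.factorial_succ]
  ring

/-- Polynomials in the oscillators, as a module over constant coefficient operators. -/
def E (n : ℕ) : Type := MvPolynomial (Fin n) ℂ

noncomputable instance (n : ℕ) : AddCommGroup (E n) :=
  inferInstanceAs (AddCommGroup (MvPolynomial (Fin n) ℂ))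
noncomputable instance instModCE (n : ℕ) : Module ℂ (E n) :=
  inferInstanceAs (Module ℂ (MvPolynomial (Fin n) ℂ))

/-- Derivative on `E`. -/
noncomputable def pd {n : ℕ} (i : Fin n) : Module.End ℂ (E n) :=
  (pderiv i : Derivation ℂ (MvPolynomial (Fin n) ℂ) _).toLinearMap

/-- Coefficient on `E`. -/
noncomputable def co {n : ℕ} (k : Fin n →₀ ℕ) : E n →ₗ[ℂ] ℂ := MvPolynomial.lcoeff ℂ k

theorem co_pd {n : ℕ} (i : Fin n) (k : Fin n →₀ ℕ) (p : E n) :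
    co k (pd i p) = co (k + Finsupp.single i 1) p * ((k i : ℂ) + 1) :=
  MvPolynomial.coeff_pderiv (R := ℂ) (i := i) p k

theorem E_ext {n : ℕ} {p q : E n} (h : ∀ k, co k p = co k q) : p = q :=
  MvPolynomial.ext _ _ h

theorem pd_comm {n : ℕ} (i j : Fin n) : (pd i * pd j : Module.End ℂ (E n)) = pd j * pd i := by
  ext1 p
  apply E_ext
  intro k
  rw [Module.End.mul_apply, Module.End.mul_apply, co_pd, co_pd, co_pd, co_pd,
    add_right_comm k]
  by_cases h : i = j
  · subst h; rfl
  · have h' : j ≠ i := fun e => h e.symm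
    simp [h, h']
    ring

noncomputable instance instModKE (n : ℕ) : Module (MvPolynomial (Fin n) ℂ) (E n) :=
  Module.compHom (E n) (actHom pd pd_comm : MvPolynomial (Fin n) ℂ →ₐ[ℂ] Module.End ℂ (E n)).toRingHom

theorem smul_def_E {n : ℕ} (r : MvPolynomial (Fin n) ℂ) (p : E n) :
    r • p = actHom pd pd_comm r p := rfl

theorem X_smul_E {n : ℕ} (i : Fin n) (p : E n) :
    (X i : MvPolynomial (Fin n) ℂ) • p = pd i p := by
  rw [smul_def_E, actHom_X]

instance (n : ℕ) : IsScalarTower ℂ (MvPolynomial (Fin n) ℂ) (E n) := ⟨fun c r p => by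
  rw [smul_def_E, smul_def_E, map_smul, LinearMap.smul_apply]⟩

theorem ind_one {n : ℕ} {p : (Fin n →₀ ℕ) → Prop} (h0 : p 0)
    (h1 : ∀ k i, p k → p (k + Finsupp.single i 1)) (k : Fin n →₀ ℕ) : p k := by
  induction k using Finsupp.induction₂ with
  | zero => exact h0
  | add_single a b f _ _ hf =>
    clear * - h1 hf
    induction b with
    | zero => simpa using hf
    | succ b ih =>
      rw [Finsupp.single_add, ← add_assoc]
      exact h1 _ _ ih

theorem co_monomial_smul {n : ℕ} (k : Fin n →₀ ℕ) : ∀ p : E n,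
    co 0 ((monomial k 1 : MvPolynomial (Fin n) ℂ) • p) = wt k * co k p := by
  refine ind_one (p := fun k => ∀ p : E n,
    co 0 ((monomial k 1 : MvPolynomial (Fin n) ℂ) • p) = wt k * co k p) ?_ ?_ k
  · intro p
    have : (monomial 0 1 : MvPolynomial (Fin n) ℂ) = 1 := rfl
    rw [this, one_smul, wt_zero, one_mul]
  · intro k i ih p
    have : (monomial (k + Finsupp.single i 1) 1 : MvPolynomial (Fin n) ℂ) = monomial k 1 * X i := by
      simp [X, monomial_mul]
    rw [this, mul_smul, ih, X_smul_E, co_pd, wt_add]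
    ring

theorem co_smul {n : ℕ} (u : MvPolynomial (Fin n) ℂ) (p : E n) :
    co 0 (u • p) = ∑ k ∈ u.support, coeff k u * (wt k * co k p) := by
  conv_lhs => rw [u.as_sum, Finset.sum_smul, map_sum]
  refine Finset.sum_congr rfl fun k _ => ?_
  have : (monomial k (coeff k u) : MvPolynomial (Fin n) ℂ) = coeff k u • monomial k 1 := by
    simp [smul_monomial]
  rw [this, smul_assoc, map_smul, co_monomial_smul, smul_eq_mul]

theorem E_sep {n : ℕ} {p q : E n}
    (h : ∀ u : MvPolynomial (Fin n) ℂ, co 0 (u • p) = co 0 (u • q)) : p = q := by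
  apply E_ext
  intro k
  have := h (monomial k 1)
  rw [co_monomial_smul, co_monomial_smul] at this
  exact mul_left_cancel₀ (wt_ne k) this

theorem E_nilp {n : ℕ} (p : E n) : ∃ N, ∀ s ∈ idealOfVars (Fin n) ℂ ^ N, s • p = 0 := by
  refine ⟨MvPolynomial.totalDegree (p : MvPolynomial (Fin n) ℂ) + 1, fun s hs => ?_⟩
  apply E_sep
  intro u
  rw [smul_zero, map_zero, smul_smul, co_smul]
  have hus := Ideal.mul_mem_left _ u hs
  rw [mem_pow_idealOfVars_iff] at hus
  refine Finset.sum_eq_zero fun k hk => ?_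
  have : co k p = 0 := by
    refine MvPolynomial.coeff_eq_zero_of_totalDegree_lt (f := (p : MvPolynomial (Fin n) ℂ)) ?_
    have := hus k hk
    rw [Finsupp.degree_apply] at this
    exact this
  rw [this]; simp

theorem E_nilp_fg {n : ℕ} (S : Submodule (MvPolynomial (Fin n) ℂ) (E n)) (hS : S.FG) :
    ∃ N, ∀ p ∈ S, ∀ s ∈ idealOfVars (Fin n) ℂ ^ N, s • p = 0 := by
  obtain ⟨T, rfl⟩ := hS
  choose N hN using fun p : E n => E_nilp p
  refine ⟨T.sup N, fun p hp s hs => ?_⟩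
  induction hp using Submodule.span_induction with
  | mem x hx => exact hN x s (Ideal.pow_le_pow_right (Finset.le_sup (f := N) hx) hs)
  | zero => simp
  | add x y _ _ hx hy => rw [smul_add, hx, hy, add_zero]
  | smul a x _ hx => rw [smul_comm, hx, smul_zero]

theorem E_realize {n : ℕ} (N : ℕ) (ψ : MvPolynomial (Fin n) ℂ →ₗ[ℂ] ℂ)
    (hψ : ∀ s ∈ idealOfVars (Fin n) ℂ ^ N, ψ s = 0) :
    ∃ e : E n, ∀ u : MvPolynomial (Fin n) ℂ, co 0 (u • e) = ψ u := by
  classical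
  let S := (Finsupp.finite_of_degree_lt (σ := Fin n) N).toFinset
  let e : MvPolynomial (Fin n) ℂ := ∑ k ∈ S, monomial k ((wt k)⁻¹ * ψ (monomial k 1))
  have he : ∀ k, wt k * co k (e : E n) = ψ (monomial k 1) := by
    intro k
    have h1 : co k (e : E n) = if k ∈ S then (wt k)⁻¹ * ψ (monomial k 1) else 0 := by
      change coeff k e = _
      simp [e, coeff_sum, coeff_monomial]
    rw [h1]
    split_ifs with h
    · rw [mul_inv_cancel_left₀ (wt_ne k)]
    · rw [mul_zero, hψ]
      rw [monomial_mem_pow_idealOfVars_iff _ _ one_ne_zero]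
      simpa [S] using h
  refine ⟨(show E n from e), fun u => ?_⟩
  rw [co_smul u (show E n from e)]
  conv_rhs => rw [u.as_sum, map_sum]
  refine Finset.sum_congr rfl fun k _ => ?_
  have : (monomial k (coeff k u) : MvPolynomial (Fin n) ℂ) = coeff k u • monomial k 1 := by
    simp [smul_monomial]
  rw [this, map_smul, smul_eq_mul, ← he]

theorem E_baer (n : ℕ) : Module.Baer (MvPolynomial (Fin n) ℂ) (E n) := by
  intro I g
  obtain ⟨N0, hN0⟩ := E_nilp_fg (LinearMap.range g) (by
    rw [LinearMap.range_eq_map]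
    exact Submodule.FG.map _ (IsNoetherian.noetherian _))
  obtain ⟨k0, hk0⟩ := Ideal.exists_pow_inf_eq_pow_smul (idealOfVars (Fin n) ℂ) I
  have hk := hk0 (N0 + k0) (by omega)
  rw [Nat.add_sub_cancel] at hk
  have hker : ∀ x (hx : x ∈ I), x ∈ idealOfVars (Fin n) ℂ ^ (N0 + k0) → g ⟨x, hx⟩ = 0 := by
    intro x hx hxm
    have h1 : x ∈ (idealOfVars (Fin n) ℂ ^ (N0 + k0) • (⊤ : Ideal (MvPolynomial (Fin n) ℂ))) ⊓ I :=
      ⟨by simpa using hxm, hx⟩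
    rw [hk] at h1
    have h2 : ∃ hx : x ∈ I, g ⟨x, hx⟩ = 0 := by
      refine Submodule.smul_induction_on (p := fun x => ∃ hx : x ∈ I, g ⟨x, hx⟩ = 0) h1 ?_ ?_
      · intro r hr y hy
        refine ⟨I.smul_mem r hy.2, ?_⟩
        have : (⟨r • y, I.smul_mem r hy.2⟩ : I) = r • ⟨y, hy.2⟩ := rfl
        rw [this, map_smul]
        exact hN0 _ ⟨_, rfl⟩ r hr
      · rintro y z ⟨hy, hgy⟩ ⟨hz, hgz⟩
        refine ⟨I.add_mem hy hz, ?_⟩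
        have : (⟨y + z, I.add_mem hy hz⟩ : I) = ⟨y, hy⟩ + ⟨z, hz⟩ := rfl
        rw [this, map_add, hgy, hgz, add_zero]
    exact h2.2
  let lam : I →ₗ[ℂ] ℂ := (co 0).comp (g.restrictScalars ℂ)
  let F : I →ₗ[ℂ] (MvPolynomial (Fin n) ℂ ⧸ (idealOfVars (Fin n) ℂ ^ (N0 + k0))) :=
    ((Submodule.mkQ (idealOfVars (Fin n) ℂ ^ (N0 + k0))).comp I.subtype).restrictScalars ℂ
  have hlam : lam ∈ LinearMap.range F.dualMap := by
    rw [LinearMap.range_dualMap_eq_dualAnnihilator_ker, Submodule.mem_dualAnnihilator]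
    rintro ⟨x, hx⟩ hF
    have : x ∈ idealOfVars (Fin n) ℂ ^ (N0 + k0) := by
      exact (Submodule.Quotient.mk_eq_zero _).mp hF
    change co 0 (g ⟨x, hx⟩) = 0
    rw [hker x hx this, map_zero]
  obtain ⟨ψ, hψ⟩ := hlam
  obtain ⟨e, he⟩ := E_realize (N0 + k0)
    (ψ.comp ((Submodule.mkQ (idealOfVars (Fin n) ℂ ^ (N0 + k0))).restrictScalars ℂ)) (by
      intro s hs
      have : Submodule.mkQ (idealOfVars (Fin n) ℂ ^ (N0 + k0)) s = 0 :=
        (Submodule.Quotient.mk_eq_zero _).mpr hs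
      rw [LinearMap.comp_apply, LinearMap.restrictScalars_apply, this, map_zero])
  refine ⟨LinearMap.toSpanSingleton _ _ e, fun x hx => ?_⟩
  rw [LinearMap.toSpanSingleton_apply]
  apply E_sep
  intro u
  rw [smul_smul, he, ← map_smul]
  have := LinearMap.congr_fun hψ (u • ⟨x, hx⟩)
  exact this

/-- `H0` as a module. -/
abbrev M (n : ℕ) := (Fin n →₀ ℕ) → E n

/-- `∂/∂Y` as a linear map. -/
noncomputable def dYl {n : ℕ} (A : Fin n) : Module.End (MvPolynomial (Fin n) ℂ) (M n) where
  toFun f := fun m => ((m A : ℂ) + 1) • f (m + Finsupp.single A 1)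
  map_add' f g := by ext1 m; simp
  map_smul' c f := by ext1 m; exact smul_comm ((m A : ℂ) + 1) c (f (m + Finsupp.single A 1))

theorem dYl_comm {n : ℕ} (i j : Fin n) : (dYl i * dYl j : Module.End _ (M n)) = dYl j * dYl i := by
  ext1 f
  ext1 k
  simp only [Module.End.mul_apply, dYl, LinearMap.coe_mk, AddHom.coe_mk, smul_smul]
  rw [add_right_comm k]
  congr 1
  by_cases h : i = j
  · subst h; rfl
  · have h' : j ≠ i := fun e => h e.symm
    simp [h, h']
    ring

/-- The ring of constant coefficient operators. -/
abbrev R (n : ℕ) := MvPolynomial (Fin n) (MvPolynomial (Fin n) ℂ)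

noncomputable instance instModRM (n : ℕ) : Module (R n) (M n) :=
  Module.compHom (M n) (actHom dYl dYl_comm :
    R n →ₐ[MvPolynomial (Fin n) ℂ] Module.End (MvPolynomial (Fin n) ℂ) (M n)).toRingHom

theorem smul_def_M {n : ℕ} (r : R n) (p : M n) :
    r • p = actHom dYl dYl_comm r p := rfl

theorem X_smul_M {n : ℕ} (i : Fin n) (p : M n) :
    (X i : R n) • p = dYl i p := by
  rw [smul_def_M, actHom_X]

instance (n : ℕ) : IsScalarTower (MvPolynomial (Fin n) ℂ) (R n) (M n) := ⟨fun c r p => by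
  rw [smul_def_M, smul_def_M, map_smul, LinearMap.smul_apply]⟩

theorem ev_monomial_smul {n : ℕ} (k : Fin n →₀ ℕ) : ∀ p : M n,
    ((monomial k 1 : R n) • p) 0 = wt k • p k := by
  refine ind_one (p := fun k => ∀ p : M n,
    ((monomial k 1 : R n) • p) 0 = wt k • p k) ?_ ?_ k
  · intro p
    have : (monomial 0 1 : R n) = 1 := rfl
    rw [this, one_smul, wt_zero, one_smul]
  · intro k i ih p
    have : (monomial (k + Finsupp.single i 1) 1 : R n) = monomial k 1 * X i := by
      simp [X, monomial_mul]
    rw [this, mul_smul, ih, X_smul_M, wt_add]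
    simp [dYl, smul_smul]

theorem M_sep {n : ℕ} {p q : M n} (h : ∀ u : R n, (u • p) 0 = (u • q) 0) : p = q := by
  ext1 k
  have := h (monomial k 1)
  rw [ev_monomial_smul, ev_monomial_smul] at this
  exact smul_right_injective _ (wt_ne k) this

theorem M_surj {n : ℕ} (I : Ideal (R n)) (x : R n) (hx : ∀ r, x * r ∈ I → r ∈ I) (h : M n)
    (hI : ∀ i ∈ I, i • h = 0) : ∃ g : M n, x • g = h ∧ ∀ i ∈ I, i • g = 0 := by
  let f : (R n ⧸ I) →ₗ[MvPolynomial (Fin n) ℂ] (R n ⧸ I) :=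
    (LinearMap.lsmul (R n) (R n ⧸ I) x).restrictScalars _
  have hf : Function.Injective f := by
    rw [injective_iff_map_eq_zero]
    intro a ha
    obtain ⟨r, rfl⟩ := Submodule.mkQ_surjective I a
    have : Submodule.mkQ I (x * r) = 0 := ha
    exact (Submodule.Quotient.mk_eq_zero _).mpr (hx r ((Submodule.Quotient.mk_eq_zero _).mp this))
  let gh0 : (R n ⧸ I) →ₗ[R n] M n := Submodule.liftQ I (LinearMap.toSpanSingleton (R n) (M n) h)
    (fun i hi => hI i hi)
  let gh : (R n ⧸ I) →ₗ[MvPolynomial (Fin n) ℂ] E n :=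
    (LinearMap.proj (0 : Fin n →₀ ℕ)).comp (gh0.restrictScalars _)
  obtain ⟨ψ, hψ⟩ := (E_baer n).extension_property f hf gh
  let g : M n := fun k => (wt k)⁻¹ • ψ (Submodule.mkQ I (monomial k 1))
  have hg : ∀ r : R n, (r • g) 0 = ψ (Submodule.mkQ I r) := by
    intro r
    induction r using MvPolynomial.induction_on' with
    | monomial k c =>
      have : (monomial k c : R n) = c • monomial k 1 := by simp [smul_monomial]
      rw [this, smul_assoc, Pi.smul_apply, ev_monomial_smul]
      have h2 : Submodule.mkQ I (c • monomial k 1) = c • Submodule.mkQ I (monomial k 1) := rfl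
      rw [h2, map_smul]
      simp only [g]
      rw [smul_inv_smul₀ (wt_ne k)]
    | add p q hp hq => rw [add_smul, Pi.add_apply, hp, hq, map_add, map_add]
  refine ⟨g, M_sep fun u => ?_, fun i hi => M_sep fun u => ?_⟩
  · rw [smul_smul, hg, mul_comm]
    exact LinearMap.congr_fun hψ (Submodule.mkQ I u)
  · rw [smul_smul, hg, smul_zero]
    have : Submodule.mkQ I (u * i) = 0 :=
      (Submodule.Quotient.mk_eq_zero _).mpr (I.mul_mem_left u hi)
    rw [this, map_zero]
    rfl

/-- Symbols of the three operators. -/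
noncomputable def sym {n : ℕ} (η : Fin n → Fin n → ℂ) (s t : Fin n → Fin n ⊕ Fin n) : R n :=
  sumAlgEquiv ℂ (Fin n) (Fin n) (quad η s t)

theorem dY_eq {n : ℕ} (A : Fin n) (f : M n) : @Eq (M n) (dY A f) ((X A : R n) • f) := by
  rw [X_smul_M]; rfl

theorem C_smul_M {n : ℕ} (c : MvPolynomial (Fin n) ℂ) (f : M n) : (C c : R n) • f = c • f := by
  rw [← algebraMap_eq, algebraMap_smul]

theorem da_eq {n : ℕ} (A : Fin n) (f : M n) : @Eq (M n) (da A f) ((C (X A) : R n) • f) := by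
  rw [C_smul_M]
  ext1 m
  rw [Pi.smul_apply, X_smul_E]
  rfl

theorem CC_smul {n : ℕ} (c : ℂ) (f : M n) : (C (C c) : R n) • f = c • f := by
  rw [C_smul_M, ← algebraMap_eq (R := ℂ), algebraMap_smul]

/-- The identity map, viewed as a linear map. -/
noncomputable def toM {n : ℕ} : H0 n →ₗ[ℂ] M n where
  toFun f := f
  map_add' _ _ := rfl
  map_smul' _ _ := rfl

theorem toM_box {n : ℕ} (η : Fin n → Fin n → ℂ) (f : H0 n) :
    toM (box η f) = ∑ A, ∑ B, η A B • toM (dY A (dY B f)) := by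
  simp only [box, map_sum, map_smul]

theorem toM_opS {n : ℕ} (η : Fin n → Fin n → ℂ) (f : H0 n) :
    toM (opS η f) = ∑ A, ∑ B, η A B • toM (da A (dY B f)) := by
  simp only [opS, map_sum, map_smul]

theorem toM_opT {n : ℕ} (η : Fin n → Fin n → ℂ) (f : H0 n) :
    toM (opT η f) = ∑ A, ∑ B, η A B • toM (da A (da B f)) := by
  simp only [opT, map_sum, map_smul]

theorem box_eq {n : ℕ} (η : Fin n → Fin n → ℂ) (f : M n) :
    @Eq (M n) (box η f) (sym η Sum.inl Sum.inl • f) := by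
  have h : sym η Sum.inl Sum.inl • f =
      ∑ A, ∑ B, η A B • ((X A : R n) • ((X B : R n) • f)) := by
    simp only [sym, quad, map_sum, map_mul, sumAlgEquiv_C_inl, sumAlgEquiv_X_inl,
      sumAlgEquiv_X_inr, Finset.sum_smul, mul_smul, CC_smul]
  rw [h]
  refine (toM_box η f).trans ?_
  refine Finset.sum_congr rfl fun A _ => Finset.sum_congr rfl fun B _ => ?_
  rw [← dY_eq, ← dY_eq]
  rfl

theorem opS_eq {n : ℕ} (η : Fin n → Fin n → ℂ) (f : M n) :
    @Eq (M n) (opS η f) (sym η Sum.inr Sum.inl • f) := by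
  have h : sym η Sum.inr Sum.inl • f =
      ∑ A, ∑ B, η A B • ((C (X A) : R n) • ((X B : R n) • f)) := by
    simp only [sym, quad, map_sum, map_mul, sumAlgEquiv_C_inl, sumAlgEquiv_X_inl,
      sumAlgEquiv_X_inr, Finset.sum_smul, mul_smul, CC_smul]
  rw [h]
  refine (toM_opS η f).trans ?_
  refine Finset.sum_congr rfl fun A _ => Finset.sum_congr rfl fun B _ => ?_
  refine congrArg (fun z : M n => η A B • z) ?_
  exact (da_eq A (dY B f)).trans (congrArg (fun z : M n => (C (X A) : R n) • z) (dY_eq B f))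

theorem opT_eq {n : ℕ} (η : Fin n → Fin n → ℂ) (f : M n) :
    @Eq (M n) (opT η f) (sym η Sum.inr Sum.inr • f) := by
  have h : sym η Sum.inr Sum.inr • f =
      ∑ A, ∑ B, η A B • ((C (X A) : R n) • ((C (X B) : R n) • f)) := by
    simp only [sym, quad, map_sum, map_mul, sumAlgEquiv_C_inl, sumAlgEquiv_X_inl,
      sumAlgEquiv_X_inr, Finset.sum_smul, mul_smul, CC_smul]
  rw [h]
  refine (toM_opT η f).trans ?_
  refine Finset.sum_congr rfl fun A _ => Finset.sum_congr rfl fun B _ => ?_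
  rw [← da_eq, ← da_eq]
  rfl

theorem coregular (n : ℕ) (hn : 3 ≤ n) (η ηinv : Fin n → Fin n → ℂ)
    (hsymm : ∀ A B, η A B = η B A)
    (hinv : ∀ A C, (∑ B, η A B * ηinv B C) = if A = C then 1 else 0) :
    ∃ y s a : R n, (∀ f : M n, @Eq (M n) (box η f) (y • f)) ∧
      (∀ f : M n, @Eq (M n) (opS η f) (s • f)) ∧ (∀ f : M n, @Eq (M n) (opT η f) (a • f)) ∧
      (∀ h : M n, ∃ g : M n, a • g = h) ∧
      (∀ h : M n, a • h = 0 → ∃ g : M n, y • g = h ∧ a • g = 0) ∧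
      (∀ h : M n, a • h = 0 → y • h = 0 → ∃ g : M n, s • g = h ∧ a • g = 0 ∧ y • g = 0) := by
  refine ⟨_, _, _, box_eq η, opS_eq η, opT_eq η, ?_⟩
  obtain ⟨m, rfl⟩ : ∃ m, n = m + 1 := ⟨n - 1, by omega⟩
  obtain ⟨e0, α, β, b, hG, ha, hy, hs⟩ := exists_equiv m (by omega) η ηinv hsymm hinv
  let e := (sumAlgEquiv ℂ (Fin (m + 1)) (Fin (m + 1))).symm.trans e0
  have he : ∀ s t, e (sym η s t) = e0 (quad η s t) := fun s t => by
    simp only [e, sym, AlgEquiv.trans_apply, AlgEquiv.symm_apply_apply]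
  rw [← he] at ha hy hs
  generalize sym η Sum.inr Sum.inr = a at *
  generalize sym η Sum.inl Sum.inl = y at *
  generalize sym η Sum.inr Sum.inl = s at *
  refine ⟨fun h => ?_, fun h hah => ?_, fun h hah hyh => ?_⟩
  · have hreg : ∀ r, a * r ∈ (⊥ : Ideal (R (m + 1))) → r ∈ (⊥ : Ideal (R (m + 1))) := by
      intro r hr
      rw [Submodule.mem_bot] at hr ⊢
      refine (mul_eq_zero.mp hr).resolve_left fun h0 => ?_
      rw [h0, map_zero] at ha
      have hmon : (Polynomial.X ^ 2 + Polynomial.C α).Monic :=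
        Polynomial.monic_X_pow_add_C _ (by norm_num)
      exact hmon.ne_zero (Polynomial.C_eq_zero.mp ha.symm)
    obtain ⟨g, hg, -⟩ := M_surj ⊥ a hreg h (by
      intro i hi
      rw [(Submodule.mem_bot _).mp hi, zero_smul])
    exact ⟨g, hg⟩
  · have hreg : ∀ r, y * r ∈ Ideal.span {a} → r ∈ Ideal.span {a} := by
      intro r hr
      obtain ⟨u, hu⟩ := Ideal.mem_span_singleton'.mp hr
      obtain ⟨v, hv⟩ := regular_two α β (e r) (e u) (by
        rw [← ha, ← hy, ← map_mul, ← map_mul, ← hu, mul_comm])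
      refine Ideal.mem_span_singleton'.mpr ⟨e.symm v, e.injective ?_⟩
      rw [hv, map_mul, e.apply_symm_apply, ha, mul_comm]
    obtain ⟨g, hg, hgI⟩ := M_surj (Ideal.span {a}) y hreg h (by
      intro i hi
      obtain ⟨c, rfl⟩ := Ideal.mem_span_singleton'.mp hi
      rw [mul_smul, hah, smul_zero])
    exact ⟨g, hg, hgI a (Ideal.mem_span_singleton_self a)⟩
  · have hreg : ∀ r, s * r ∈ Ideal.span {a, y} → r ∈ Ideal.span {a, y} := by
      intro r hr
      obtain ⟨u, v, hu⟩ := Ideal.mem_span_pair.mp hr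
      obtain ⟨u', v', hv⟩ := regular_three α β b hG (e r) (e u) (e v) (by
        rw [← ha, ← hy, ← hs, ← map_mul, ← map_mul, ← map_mul, ← map_add, ← hu, mul_comm a,
          mul_comm y])
      refine Ideal.mem_span_pair.mpr ⟨e.symm u', e.symm v', e.injective ?_⟩
      rw [hv, map_add, map_mul, map_mul, e.apply_symm_apply, e.apply_symm_apply, ha, hy,
        mul_comm u', mul_comm v']
    obtain ⟨g, hg, hgI⟩ := M_surj (Ideal.span {a, y}) s hreg h (by
      intro i hi
      obtain ⟨c, d, rfl⟩ := Ideal.mem_span_pair.mp hi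
      rw [add_smul, mul_smul, mul_smul, hah, hyh, smul_zero, smul_zero, add_zero])
    exact ⟨g, hg, hgI a (Ideal.subset_span (by simp)), hgI y (Ideal.subset_span (by simp))⟩

/-- The differential in abstract form. -/
noncomputable def Om {n : ℕ} (y s a : R n) (f : Bool × Bool × Bool → M n) :
    Bool × Bool × Bool → M n := fun ε =>
  (if ε.1 = true then y • (f (false, ε.2.1, ε.2.2)) else 0)
  + (if ε.2.1 = true then ((-1 : ℂ) ^ ε.1.toNat) • s • (f (ε.1, false, ε.2.2)) else 0)
  + (if ε.2.2 = true then ((-1 : ℂ) ^ (ε.1.toNat + ε.2.1.toNat)) • a • (f (ε.1, ε.2.1, false))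
      else 0)

theorem Om_ext {n : ℕ} {f g : Bool × Bool × Bool → M n}
    (h0 : f (false, false, false) = g (false, false, false))
    (h1 : f (true, false, false) = g (true, false, false))
    (h2 : f (false, true, false) = g (false, true, false))
    (h3 : f (false, false, true) = g (false, false, true))
    (h12 : f (true, true, false) = g (true, true, false))
    (h13 : f (true, false, true) = g (true, false, true))
    (h23 : f (false, true, true) = g (false, true, true))
    (h123 : f (true, true, true) = g (true, true, true)) : f = g := by
  funext ε
  obtain ⟨_ | _, _ | _, _ | _⟩ := ε <;> assumption

section comps
variable {n : ℕ} (y s a : R n) (f : Bool × Bool × Bool → M n)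

theorem Om0 : Om y s a f (false, false, false) = 0 := by simp [Om]
theorem Om1 : Om y s a f (true, false, false) = y • f (false, false, false) := by simp [Om]
theorem Om2 : Om y s a f (false, true, false) = s • f (false, false, false) := by simp [Om]
theorem Om3 : Om y s a f (false, false, true) = a • f (false, false, false) := by simp [Om]
theorem Om12 : Om y s a f (true, true, false) =
    y • f (false, true, false) - s • f (true, false, false) := by simp [Om, sub_eq_add_neg]
theorem Om13 : Om y s a f (true, false, true) =
    y • f (false, false, true) - a • f (true, false, false) := by simp [Om, sub_eq_add_neg]
theorem Om23 : Om y s a f (false, true, true) =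
    s • f (false, false, true) - a • f (false, true, false) := by simp [Om, sub_eq_add_neg]
theorem Om123 : Om y s a f (true, true, true) =
    y • f (false, true, true) - s • f (true, false, true) + a • f (true, true, false) := by
  simp [Om, sub_eq_add_neg]

theorem Om_sq : Om y s a (Om y s a f) = 0 := by
  apply Om_ext <;>
    simp only [Om0, Om1, Om2, Om3, Om12, Om13, Om23, Om123, Pi.zero_apply, smul_zero, smul_sub,
      smul_smul, mul_comm s y, mul_comm a y, mul_comm a s] <;> abel

end comps

theorem Om_zero {n : ℕ} (y s a : R n) (f : Bool × Bool × Bool → M n)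
    (hf : ∀ ε, ε ≠ (false, false, false) → f ε = 0)
    (z1 : y • f (false, false, false) = 0) (z2 : s • f (false, false, false) = 0)
    (z3 : a • f (false, false, false) = 0) : Om y s a f = 0 := by
  have q1 := hf (true, false, false) (by decide)
  have q2 := hf (false, true, false) (by decide)
  have q3 := hf (false, false, true) (by decide)
  have q12 := hf (true, true, false) (by decide)
  have q13 := hf (true, false, true) (by decide)
  have q23 := hf (false, true, true) (by decide)
  apply Om_ext <;>
    simp only [Om0, Om1, Om2, Om3, Om12, Om13, Om23, Om123, q1, q2, q3, q12, q13, q23, z1, z2, z3,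
      smul_zero, sub_zero, add_zero, Pi.zero_apply]

theorem koszul {n : ℕ} (y s a : R n)
    (c1 : ∀ h : M n, ∃ g : M n, a • g = h)
    (c2 : ∀ h : M n, a • h = 0 → ∃ g : M n, y • g = h ∧ a • g = 0)
    (c3 : ∀ h : M n, a • h = 0 → y • h = 0 → ∃ g : M n, s • g = h ∧ a • g = 0 ∧ y • g = 0)
    (k : ℕ) (hk : 1 ≤ k) (f : Bool × Bool × Bool → M n) (hf : ∀ ε, deg ε ≠ k → f ε = 0)
    (hO : Om y s a f = 0) : ∃ g, Om y s a g = f := by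
  have comm : ∀ (r r' : R n) (z : M n), r • r' • z = r' • r • z := fun r r' z => smul_comm r r' z
  have p12 := congrFun hO (true, true, false)
  have p13 := congrFun hO (true, false, true)
  have p23 := congrFun hO (false, true, true)
  have p123 := congrFun hO (true, true, true)
  rw [Om12, Pi.zero_apply, sub_eq_zero] at p12
  rw [Om13, Pi.zero_apply, sub_eq_zero] at p13
  rw [Om23, Pi.zero_apply, sub_eq_zero] at p23
  rw [Om123, Pi.zero_apply] at p123
  have hk' : k = 1 ∨ k = 2 ∨ k = 3 ∨ 4 ≤ k := by omega
  rcases hk' with rfl | rfl | rfl | hk4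
  · obtain ⟨g0, h0⟩ := c1 (f (false, false, true))
    obtain ⟨g1, h1, h1a⟩ := c2 (f (true, false, false) - y • g0) (by
      rw [smul_sub, comm a y, h0, p13, sub_self])
    obtain ⟨g2, h2, h2a, h2y⟩ := c3 (f (false, true, false) - s • (g0 + g1)) (by
      rw [smul_sub, comm a s, smul_add, h0, h1a, add_zero, p23, sub_self]) (by
      rw [smul_sub, comm y s, smul_add, h1, p12, add_sub_cancel, sub_self])
    refine ⟨fun ε => if ε = (false, false, false) then g0 + g1 + g2 else 0, ?_⟩
    apply Om_ext <;>
      simp only [Om0, Om1, Om2, Om3, Om12, Om13, Om23, Om123, Prod.mk.injEq, reduceCtorEq,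
        and_true, and_false, true_and, false_and, and_self, if_true, if_false, smul_zero, sub_zero,
        add_zero]
    · exact (hf _ (by decide)).symm
    · rw [smul_add, smul_add, h1, h2y]; abel
    · rw [smul_add s (g0 + g1), h2]; abel
    · rw [smul_add, smul_add, h0, h1a, h2a]; abel
    all_goals exact (hf _ (by decide)).symm
  · obtain ⟨g1, h1⟩ := c1 (- f (true, false, true))
    obtain ⟨v0, h0⟩ := c1 (- f (false, true, true))
    obtain ⟨v1, hv, hva⟩ := c2 (f (true, true, false) - y • v0 + s • g1) (by
      rw [smul_add, smul_sub, comm a y, comm a s, h0, h1, ← p123, smul_neg, smul_neg]; abel)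
    refine ⟨fun ε => if ε = (true, false, false) then g1 else
      if ε = (false, true, false) then v0 + v1 else 0, ?_⟩
    apply Om_ext <;>
      simp only [Om0, Om1, Om2, Om3, Om12, Om13, Om23, Om123, Prod.mk.injEq, reduceCtorEq,
        and_true, and_false, true_and, false_and, and_self, if_true, if_false, smul_zero, sub_zero,
        zero_sub, add_zero]
    · exact (hf _ (by decide)).symm
    · exact (hf _ (by decide)).symm
    · exact (hf _ (by decide)).symm
    · exact (hf _ (by decide)).symm
    · rw [smul_add, hv]; abel
    · rw [h1, neg_neg]
    · rw [smul_add, h0, hva, add_zero, neg_neg]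
    · exact (hf _ (by decide)).symm
  · obtain ⟨g, h⟩ := c1 (f (true, true, true))
    refine ⟨fun ε => if ε = (true, true, false) then g else 0, ?_⟩
    apply Om_ext <;>
      simp only [Om0, Om1, Om2, Om3, Om12, Om13, Om23, Om123, Prod.mk.injEq, reduceCtorEq,
        and_true, and_false, true_and, false_and, and_self, if_true, if_false, smul_zero, sub_zero,
        zero_sub, zero_add, add_zero, h]
    all_goals exact (hf _ (by decide)).symm
  · have hz : f = 0 := by
      funext ε
      refine hf ε ?_
      have : deg ε ≤ 3 := by
        obtain ⟨_ | _, _ | _, _ | _⟩ := ε <;> decide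
      omega
    exact ⟨f, by rw [hO, hz]⟩
end HStrace


open HStrace in
/-- For `d+1 ≥ 3`, the operator `Ω_trace = c₀□ + c†S + ξT` on
`ℂ[[Y]] ⊗ ℂ[a†] ⊗ Λ[c₀,c†,ξ]` squares to zero, its cohomology in positive
ghost degree vanishes, and in ghost degree zero a ghost-independent element is
a cocycle iff it is totally traceless (annihilated by `□`, `S`, `T`). -/
theorem Omega_trace_cohomology
    (n : ℕ) (hn : 3 ≤ n) (η ηinv : Fin n → Fin n → ℂ)
    (hsymm : ∀ A B, η A B = η B A)
    (hinv : ∀ A C, (∑ B, η A B * ηinv B C) = if A = C then 1 else 0) :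
    (∀ f : H n, OmTrace η (OmTrace η f) = 0) ∧
    (∀ k : ℕ, 1 ≤ k → ∀ f : H n, (∀ ε, deg ε ≠ k → f ε = 0) →
      OmTrace η f = 0 → ∃ g : H n, OmTrace η g = f) ∧
    (∀ f : H n, (∀ ε, ε ≠ (false, false, false) → f ε = 0) →
      (OmTrace η f = 0 ↔
        (box η (f (false, false, false)) = 0 ∧
          opS η (f (false, false, false)) = 0 ∧
          opT η (f (false, false, false)) = 0))) := by
  obtain ⟨y, s, a, hy, hs, ha, c1, c2, c3⟩ := coregular n hn η ηinv hsymm hinv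
  have key : ∀ f : H n, OmTrace η f = Om y s a f := by
    intro f
    funext ε
    show _ = (if ε.1 = true then y • (show M n from f (false, ε.2.1, ε.2.2)) else 0)
      + (if ε.2.1 = true then
          ((-1 : ℂ) ^ ε.1.toNat) • s • (show M n from f (ε.1, false, ε.2.2)) else 0)
      + (if ε.2.2 = true then
          ((-1 : ℂ) ^ (ε.1.toNat + ε.2.1.toNat)) • a • (show M n from f (ε.1, ε.2.1, false))
        else 0)
    rw [← hy, ← hs, ← ha]
    rfl
  refine ⟨fun f => ?_, fun k hk f hf hO => ?_, fun f hf => ?_⟩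
  · rw [key, key]
    exact Om_sq y s a f
  · rw [key] at hO
    obtain ⟨g, hg⟩ := koszul y s a c1 c2 c3 k hk f hf hO
    exact ⟨g, (key g).trans hg⟩
  · rw [key]
    have e1 := Om1 y s a f
    have e2 := Om2 y s a f
    have e3 := Om3 y s a f
    constructor
    · intro h
      refine ⟨(hy _).trans (e1.symm.trans (congrFun h _)),
        (hs _).trans (e2.symm.trans (congrFun h _)), (ha _).trans (e3.symm.trans (congrFun h _))⟩
    · rintro ⟨h1, h2, h3⟩
      exact Om_zero y s a f hf ((hy _).symm.trans h1) ((hs _).symm.trans h2)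
        ((ha _).symm.trans h3)
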